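/- The measure ν is a T-invariant ergodic Borel probability measure on [0,1] which is equivalent to the Erdős measure μ (i.e. ν and μ are mutually absolutely continuous): ν(T⁻¹E) = ν(E) for every Borel set E, every Borel set E with T⁻¹E = E satisfies ν(E) ∈ {0,1}, and ν(E) = 0 if and only if μ(E) = 0. -/

import Mathlib

open MeasureTheory Filter Topology
open scoped ENNReal

/-- The golden ratio λ = (1+√5)/2. -/
noncomputable def gold : ℝ := (1 + Real.sqrt 5) / 2

/-- `p` is the Bernoulli (1/2,1/2) product measure on `{0,1}^ℕ`, characterized by its
values on cylinder sets. -/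
def IsCoinMeasure (p : Measure (ℕ → Bool)) : Prop :=
  ∀ (s : Finset ℕ) (b : ℕ → Bool), p {ε | ∀ i ∈ s, ε i = b i} = (2 : ℝ≥0∞)⁻¹ ^ s.card

/-- π(ε) = Σ_{k=1}^∞ ε_k λ^{-k-1} (indices shifted so that `ε k` is `ε_{k+1}`). -/
noncomputable def piMap (ε : ℕ → Bool) : ℝ := ∑' k : ℕ, if ε k then gold⁻¹ ^ (k + 2) else 0

/-- The Erdős measure: the pushforward of the coin measure `p` under `piMap`. -/
noncomputable def erdosOf (p : Measure (ℕ → Bool)) : Measure ℝ := p.map piMap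

/-- The measure ν, defined piecewise from the Erdős measure:
`ν E = (2/3)μ(E) + (1/3)μ(E+λ⁻²) + (1/6)μ(E+λ⁻¹)` for `E ⊆ [0,λ⁻²)`,
`ν E = (2/3)μ(E) + (1/3)μ(E+λ⁻²)` for `E ⊆ [λ⁻²,λ⁻¹)`,
`ν E = (1/2)μ(E) + (1/3)μ(E−λ⁻¹)` for `E ⊆ [λ⁻¹,1]`,
and by countable additivity in general. -/
noncomputable def nuOf (p : Measure (ℕ → Bool)) : Measure ℝ :=
  ((2 / 3 : ℝ≥0∞) • erdosOf p + (3⁻¹ : ℝ≥0∞) • (erdosOf p).map (fun x => x - gold⁻¹ ^ 2)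
      + (6⁻¹ : ℝ≥0∞) • (erdosOf p).map (fun x => x - gold⁻¹)).restrict
        (Set.Ico 0 (gold⁻¹ ^ 2))
    + ((2 / 3 : ℝ≥0∞) • erdosOf p
        + (3⁻¹ : ℝ≥0∞) • (erdosOf p).map (fun x => x - gold⁻¹ ^ 2)).restrict
        (Set.Ico (gold⁻¹ ^ 2) gold⁻¹)
    + ((2⁻¹ : ℝ≥0∞) • erdosOf p + (3⁻¹ : ℝ≥0∞) • (erdosOf p).map (fun x => x + gold⁻¹)).restrict
        (Set.Icc gold⁻¹ 1)

lemma inv_gold_sq : gold⁻¹ ^ 2 = 1 - gold⁻¹ := by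
  have h5 : Real.sqrt 5 ^ 2 = 5 := Real.sq_sqrt (by norm_num)
  have hpos : 0 < gold := by unfold gold; positivity
  have hq : gold ^ 2 = gold + 1 := by unfold gold; linear_combination h5 / 4
  field_simp
  linear_combination -hq

lemma gold_eq : gold = 1 + gold⁻¹ := by
  have hpos : 0 < gold := by unfold gold; positivity
  have h := inv_gold_sq
  field_simp at h ⊢
  linear_combination -h

lemma inv_gold_pos : 0 < gold⁻¹ := by unfold gold; positivity

/-! ### Measures on the space of binary sequences -/

/-- Prepend the digit `c` to a sequence. -/
def consSeq (c : Bool) (ε : ℕ → Bool) : ℕ → Bool := fun n => Nat.casesOn n c ε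

lemma measurable_consSeq (c : Bool) : Measurable (consSeq c) := by
  refine measurable_pi_lambda _ fun n => ?_
  cases n with
  | zero => exact measurable_const
  | succ n => exact measurable_pi_apply n

/-- The sequences that agree with `b` on the first `n` digits. -/
def initCyl (n : ℕ) (b : ℕ → Bool) : Set (ℕ → Bool) := {ε | ∀ i ∈ Finset.range n, ε i = b i}

lemma measurableSet_initCyl (n : ℕ) (b : ℕ → Bool) : MeasurableSet (initCyl n b) := by
  have : initCyl n b = ⋂ i ∈ Finset.range n, (fun ε : ℕ → Bool => ε i) ⁻¹' {b i} := by
    ext ε; simp [initCyl]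
  rw [this]
  exact Finset.measurableSet_biInter _ fun i _ =>
    measurable_pi_apply i (measurableSet_singleton _)

lemma isPiSystem_initCyl : IsPiSystem {S | ∃ n b, S = initCyl n b} := by
  rintro _ ⟨n, b, rfl⟩ _ ⟨m, b', rfl⟩ ⟨ε, h1, h2⟩
  refine ⟨max n m, ε, ?_⟩
  ext δ
  simp only [initCyl, Finset.mem_range, Set.mem_inter_iff, Set.mem_ofPred_eq, lt_max_iff] at *
  constructor
  · rintro ⟨h3, h4⟩ i (hi | hi)
    · rw [h3 i hi, h1 i hi]
    · rw [h4 i hi, h2 i hi]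
  · intro h
    exact ⟨fun i hi => by rw [h i (Or.inl hi), h1 i hi],
      fun i hi => by rw [h i (Or.inr hi), h2 i hi]⟩

lemma generateFrom_initCyl :
    (MeasurableSpace.pi : MeasurableSpace (ℕ → Bool)) =
      MeasurableSpace.generateFrom {S | ∃ n b, S = initCyl n b} := by
  apply le_antisymm
  · refine iSup_le fun i => ?_
    rw [← measurable_iff_comap_le]
    refine @measurable_to_countable' _ _ _ _ (_) _ fun c => ?_
    have : (fun ε : ℕ → Bool => ε i) ⁻¹' {c} =
        ⋃ b : {b : Fin (i + 1) → Bool // b (Fin.last i) = c},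
          initCyl (i + 1) (fun j => if h : j < i + 1 then b.1 ⟨j, h⟩ else false) := by
      ext ε
      simp only [initCyl, Set.mem_preimage, Set.mem_singleton_iff, Set.mem_iUnion,
        Set.mem_ofPred_eq, Finset.mem_range]
      constructor
      · intro h
        refine ⟨⟨fun j => ε j, h⟩, fun j hj => ?_⟩
        simp [hj]
      · rintro ⟨b, hb⟩
        have := hb i (by omega)
        simp only [lt_add_iff_pos_right, zero_lt_one, dif_pos] at this
        rw [this]
        exact b.2
    rw [this]
    refine MeasurableSet.iUnion fun b => MeasurableSpace.measurableSet_generateFrom ⟨_, _, rfl⟩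
  · refine MeasurableSpace.generateFrom_le ?_
    rintro _ ⟨n, b, rfl⟩
    exact measurableSet_initCyl n b

lemma preimage_consSeq_initCyl (c : Bool) (n : ℕ) (b : ℕ → Bool) :
    consSeq c ⁻¹' initCyl (n + 1) b = if c = b 0 then initCyl n (fun k => b (k + 1)) else ∅ := by
  ext ε
  have : ε ∈ consSeq c ⁻¹' initCyl (n + 1) b ↔
      c = b 0 ∧ ε ∈ initCyl n (fun k => b (k + 1)) := by
    simp only [initCyl, Set.mem_preimage, Set.mem_ofPred_eq, Finset.mem_range]
    constructor
    · intro h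
      exact ⟨h 0 (by omega), fun i hi => h (i + 1) (by omega)⟩
    · rintro ⟨h0, h⟩ i hi
      cases i with
      | zero => exact h0
      | succ i => exact h i (by omega)
  rw [this]
  split_ifs with h <;> simp [h]

/-- A finite measure on binary sequences is determined by its values on initial cylinders. -/
lemma ext_of_initCyl {q q' : Measure (ℕ → Bool)} [IsFiniteMeasure q]
    (h : ∀ n b, q (initCyl n b) = q' (initCyl n b)) : q = q' := by
  refine ext_of_generate_finite _ generateFrom_initCyl isPiSystem_initCyl ?_ ?_
  · rintro _ ⟨n, b, rfl⟩
    exact h n b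
  · simpa [initCyl] using h 0 (fun _ => true)

lemma half_preimage_initCyl (q : Measure (ℕ → Bool)) (n : ℕ) (b : ℕ → Bool) :
    (2 : ℝ≥0∞)⁻¹ * q (consSeq false ⁻¹' initCyl (n + 1) b)
      + 2⁻¹ * q (consSeq true ⁻¹' initCyl (n + 1) b)
      = 2⁻¹ * q (initCyl n (fun k => b (k + 1))) := by
  rw [preimage_consSeq_initCyl, preimage_consSeq_initCyl]
  cases b 0 <;> simp

lemma initCyl_of_selfSimilar {q : Measure (ℕ → Bool)}
    (h : ∀ S, MeasurableSet S →
      q S = 2⁻¹ * q (consSeq false ⁻¹' S) + 2⁻¹ * q (consSeq true ⁻¹' S)) (n : ℕ) (b : ℕ → Bool) :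
    q (initCyl n b) = q Set.univ * 2⁻¹ ^ n := by
  induction n generalizing b with
  | zero => simp [initCyl]
  | succ n ih =>
    rw [h _ (measurableSet_initCyl _ _), half_preimage_initCyl, ih, pow_succ]
    ring

namespace IsCoinMeasure

variable {p : Measure (ℕ → Bool)}

lemma apply_initCyl (hp : IsCoinMeasure p) (n : ℕ) (b : ℕ → Bool) :
    p (initCyl n b) = 2⁻¹ ^ n := by
  simpa [initCyl] using hp (Finset.range n) b

lemma isProbabilityMeasure (hp : IsCoinMeasure p) : IsProbabilityMeasure p :=
  ⟨by simpa [initCyl] using hp.apply_initCyl 0 (fun _ => true)⟩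

lemma apply_eq (hp : IsCoinMeasure p) {S : Set (ℕ → Bool)} (hS : MeasurableSet S) :
    p S = 2⁻¹ * p (consSeq false ⁻¹' S) + 2⁻¹ * p (consSeq true ⁻¹' S) := by
  have := hp.isProbabilityMeasure
  have key : p = (2⁻¹ : ℝ≥0∞) • p.map (consSeq false) + (2⁻¹ : ℝ≥0∞) • p.map (consSeq true) := by
    refine ext_of_initCyl fun n b => ?_
    simp only [Measure.coe_add, Measure.coe_smul, Pi.add_apply, Pi.smul_apply, smul_eq_mul]
    rw [Measure.map_apply (measurable_consSeq _) (measurableSet_initCyl _ _),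
      Measure.map_apply (measurable_consSeq _) (measurableSet_initCyl _ _)]
    cases n with
    | zero => simp [initCyl, ENNReal.inv_two_add_inv_two]
    | succ n =>
      rw [half_preimage_initCyl, hp.apply_initCyl, hp.apply_initCyl, pow_succ, mul_comm]
  conv_lhs => rw [key]
  simp only [Measure.coe_add, Measure.coe_smul, Pi.add_apply, Pi.smul_apply, smul_eq_mul]
  rw [Measure.map_apply (measurable_consSeq _) hS, Measure.map_apply (measurable_consSeq _) hS]

/-- A set that is almost surely unaffected by prepending a digit has probability `0` or `1`. -/
lemma zero_or_one (hp : IsCoinMeasure p) {A : Set (ℕ → Bool)} (hA : MeasurableSet A)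
    (h : ∀ c, consSeq c ⁻¹' A =ᵐ[p] A) : p A = 0 ∨ p A = 1 := by
  have := hp.isProbabilityMeasure
  have hq : ∀ S, MeasurableSet S → p.restrict A S =
      2⁻¹ * p.restrict A (consSeq false ⁻¹' S) + 2⁻¹ * p.restrict A (consSeq true ⁻¹' S) := by
    intro S hS
    rw [Measure.restrict_apply hS, Measure.restrict_apply (measurable_consSeq _ hS),
      Measure.restrict_apply (measurable_consSeq _ hS), hp.apply_eq (hS.inter hA)]
    have hc : ∀ c, p (consSeq c ⁻¹' (S ∩ A)) = p (consSeq c ⁻¹' S ∩ A) := fun c =>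
      measure_congr ((ae_eq_refl _).inter (h c))
    rw [hc, hc]
  have key : p.restrict A = p A • p := by
    refine ext_of_initCyl fun n b => ?_
    rw [initCyl_of_selfSimilar hq, Measure.smul_apply, hp.apply_initCyl,
      Measure.restrict_apply_univ, smul_eq_mul]
  have h2 : p A = p A * p A := by
    have := congrArg (fun q => q A) key
    simpa using this
  by_cases h0 : p A = 0
  · exact Or.inl h0
  · right
    have h3 : p A * 1 = p A * p A := by rw [mul_one, ← h2]
    exact ((ENNReal.mul_right_inj h0 (measure_ne_top p A)).1 h3).symm

end IsCoinMeasure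

/-! ### The digit map -/

lemma summable_inv_gold : Summable fun k : ℕ => gold⁻¹ ^ (k + 2) := by
  have h := inv_gold_sq
  have h0 := inv_gold_pos
  exact (summable_nat_add_iff 2).2 (summable_geometric_of_lt_one h0.le (by nlinarith))

lemma summable_digits (ε : ℕ → Bool) :
    Summable fun k : ℕ => if ε k then gold⁻¹ ^ (k + 2) else 0 := by
  have h0 := inv_gold_pos
  refine Summable.of_nonneg_of_le (fun k => ?_) (fun k => ?_) summable_inv_gold <;>
    split_ifs <;> first | positivity | simp

lemma measurable_piMap : Measurable piMap := by
  have h0 := inv_gold_pos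
  refine Continuous.measurable ?_
  refine continuous_tsum (fun k => ?_) summable_inv_gold (fun k ε => ?_)
  · exact (continuous_of_discreteTopology
      (f := fun c : Bool => if c then gold⁻¹ ^ (k + 2) else 0)).comp (continuous_apply k)
  · split_ifs
    · rw [Real.norm_of_nonneg (by positivity)]
    · simp only [norm_zero]; positivity

lemma piMap_consSeq (c : Bool) (ε : ℕ → Bool) :
    piMap (consSeq c ε) = gold⁻¹ * piMap ε + if c then gold⁻¹ ^ 2 else 0 := by
  unfold piMap
  rw [(summable_digits _).tsum_eq_zero_add, add_comm, ← tsum_mul_left]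
  congr 1
  refine tsum_congr fun k => ?_
  simp only [consSeq]
  rcases Bool.eq_false_or_eq_true (ε k) with h | h <;> simp only [h] <;> simp
  ring

lemma piMap_mem_Icc (ε : ℕ → Bool) : piMap ε ∈ Set.Icc (0 : ℝ) 1 := by
  have h0 := inv_gold_pos
  have h := inv_gold_sq
  have h1 : gold⁻¹ < 1 := by nlinarith
  constructor
  · exact tsum_nonneg fun k => by split_ifs <;> positivity
  · calc piMap ε ≤ ∑' k : ℕ, gold⁻¹ ^ (k + 2) := by
          refine (summable_digits ε).tsum_le_tsum (fun k => ?_) summable_inv_gold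
          split_ifs
          · exact le_rfl
          · positivity
      _ = 1 := by
          simp_rw [pow_add]
          rw [tsum_mul_right, tsum_geometric_of_lt_one h0.le h1, h]
          exact inv_mul_cancel₀ (by linarith)

/-! ### Self-similar measures -/

/-- Probability measures on `[0, 1]` that are stationary for the iterated function system
`x ↦ g x`, `x ↦ g x + g²` with equal weights. -/
structure IsSelfSimilar (g : ℝ) (μ : Measure ℝ) : Prop where
  prob : IsProbabilityMeasure μ
  supp : ∀ᵐ x ∂μ, x ∈ Set.Icc (0 : ℝ) 1
  split : ∀ S : Set ℝ, MeasurableSet S →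
    μ.real S = (μ.real {x | g * x ∈ S} + μ.real {x | g * x + g ^ 2 ∈ S}) / 2

lemma IsCoinMeasure.isSelfSimilar {p : Measure (ℕ → Bool)} (hp : IsCoinMeasure p) :
    IsSelfSimilar gold⁻¹ (erdosOf p) := by
  have := hp.isProbabilityMeasure
  refine ⟨Measure.isProbabilityMeasure_map measurable_piMap.aemeasurable, ?_, fun S hS => ?_⟩
  · exact (ae_map_iff measurable_piMap.aemeasurable measurableSet_Icc).2
      (ae_of_all _ piMap_mem_Icc)
  · have h1 : MeasurableSet {x : ℝ | gold⁻¹ * x ∈ S} := measurable_const_mul _ hS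
    have h2 : MeasurableSet {x : ℝ | gold⁻¹ * x + gold⁻¹ ^ 2 ∈ S} :=
      ((measurable_const_mul gold⁻¹).add_const _) hS
    have e1 : consSeq false ⁻¹' (piMap ⁻¹' S) = piMap ⁻¹' {x : ℝ | gold⁻¹ * x ∈ S} := by
      ext ε; simp [piMap_consSeq]
    have e2 : consSeq true ⁻¹' (piMap ⁻¹' S) =
        piMap ⁻¹' {x : ℝ | gold⁻¹ * x + gold⁻¹ ^ 2 ∈ S} := by
      ext ε; simp [piMap_consSeq]
    simp only [erdosOf, measureReal_def]
    rw [Measure.map_apply measurable_piMap hS, Measure.map_apply measurable_piMap h1,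
      Measure.map_apply measurable_piMap h2, hp.apply_eq (measurable_piMap hS), e1, e2,
      ENNReal.toReal_add (by finiteness) (by finiteness)]
    simp only [ENNReal.toReal_mul, ENNReal.toReal_inv, ENNReal.toReal_ofNat]
    ring

namespace IsSelfSimilar

variable {g : ℝ} {μ : Measure ℝ}

lemma real_zero (h : IsSelfSimilar g μ) (h0 : 0 < g) : μ.real {0} = 0 := by
  have := h.prob
  have hs := h.split {0} (measurableSet_singleton 0)
  have e1 : {x : ℝ | g * x ∈ ({0} : Set ℝ)} = {0} := by ext x; simp [h0.ne']
  have e2 : μ.real {x : ℝ | g * x + g ^ 2 ∈ ({0} : Set ℝ)} = 0 := by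
    rw [measureReal_eq_zero_iff]
    refine measure_mono_null (fun x hx => ?_) (ae_iff.1 h.supp)
    simp only [Set.mem_singleton_iff, Set.mem_ofPred_eq] at hx
    intro hx'
    nlinarith [hx'.1]
  rw [e1, e2] at hs
  linarith

lemma real_one (h : IsSelfSimilar g μ) (h0 : 0 < g) (hg : g ^ 2 = 1 - g) : μ.real {1} = 0 := by
  have := h.prob
  have hs := h.split {1} (measurableSet_singleton 1)
  have e1 : {x : ℝ | g * x + g ^ 2 ∈ ({1} : Set ℝ)} = {1} := by
    ext x
    simp only [Set.mem_singleton_iff, Set.mem_ofPred_eq]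
    constructor
    · intro hx
      have : g * (x - 1) = 0 := by linarith
      rcases mul_eq_zero.1 this with h | h <;> linarith
    · rintro rfl; linarith
  have e2 : μ.real {x : ℝ | g * x ∈ ({1} : Set ℝ)} = 0 := by
    rw [measureReal_eq_zero_iff]
    refine measure_mono_null (fun x hx => ?_) (ae_iff.1 h.supp)
    simp only [Set.mem_singleton_iff, Set.mem_ofPred_eq] at hx
    intro hx'
    nlinarith [hx'.2]
  rw [e1, e2] at hs
  linarith

lemma ae_mem_Ioo (h : IsSelfSimilar g μ) (h0 : 0 < g) (hg : g ^ 2 = 1 - g) :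
    ∀ᵐ x ∂μ, x ∈ Set.Ioo (0 : ℝ) 1 := by
  have := h.prob
  have z0 := (measureReal_eq_zero_iff).1 (h.real_zero h0)
  have z1 := (measureReal_eq_zero_iff).1 (h.real_one h0 hg)
  filter_upwards [h.supp, compl_mem_ae_iff.2 z0, compl_mem_ae_iff.2 z1] with x hx hx0 hx1
  exact ⟨lt_of_le_of_ne hx.1 (Ne.symm hx0), lt_of_le_of_ne hx.2 hx1⟩

lemma real_congr (h : IsSelfSimilar g μ) (h0 : 0 < g) (hg : g ^ 2 = 1 - g) {P Q : Set ℝ}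
    (hPQ : ∀ x, 0 < x → x < 1 → (x ∈ P ↔ x ∈ Q)) : μ.real P = μ.real Q := by
  refine measureReal_congr ?_
  filter_upwards [h.ae_mem_Ioo h0 hg] with x hx
  exact propext (hPQ x hx.1 hx.2)

lemma real_eq_zero (h : IsSelfSimilar g μ) (h0 : 0 < g) (hg : g ^ 2 = 1 - g) {P : Set ℝ}
    (hP : ∀ x, 0 < x → x < 1 → x ∉ P) : μ.real P = 0 := by
  rw [h.real_congr h0 hg (Q := ∅) fun x hx hx' => by simp [hP x hx hx']]
  simp

lemma real_eq_one (h : IsSelfSimilar g μ) (h0 : 0 < g) (hg : g ^ 2 = 1 - g) {P : Set ℝ}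
    (hP : ∀ x, 0 < x → x < 1 → x ∈ P) : μ.real P = 1 := by
  have := h.prob
  rw [h.real_congr h0 hg (Q := Set.univ) fun x hx hx' => by simp [hP x hx hx']]
  simp

lemma real_add (h : IsSelfSimilar g μ) {P Q R : Set ℝ}
    (hQ : MeasurableSet Q) (hPQR : P = Q ∪ R) (hd : Disjoint R Q) :
    μ.real P = μ.real R + μ.real Q := by
  have := h.prob
  rw [hPQR, Set.union_comm, measureReal_union hd hQ]

/-- Null subsets of `[0, ∞)` remain null when translated by `g`. -/
lemma null_sub (h : IsSelfSimilar g μ) (h0 : 0 < g) (hg : g ^ 2 = 1 - g) {N : Set ℝ}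
    (hN : MeasurableSet N) (hN0 : N ⊆ Set.Ici 0) (hz : μ.real N = 0) :
    μ.real {x | x - g ∈ N} = 0 := by
  have := h.prob
  have key : ∀ n : ℕ, ∀ N : Set ℝ, MeasurableSet N → N ⊆ Set.Ici 0 → μ.real N = 0 →
      μ.real {x | x - g ∈ N} ≤ (1 / 4) ^ n := by
    intro n
    induction n with
    | zero => intro N _ _ _; simp
    | succ n ih =>
      intro N hN hN0 hz
      have m1 : MeasurableSet {x | x - g ∈ N} := (measurable_sub_const g) hN
      have m2 : MeasurableSet {x | g * x + g ^ 2 - g ∈ N} :=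
        (((measurable_const_mul g).add_const _).sub_const _) hN
      have m3 : MeasurableSet {x | g * x ∈ N} := (measurable_const_mul g) hN
      have m4 : MeasurableSet {x | g * (g * x) ∈ N} :=
        ((measurable_const_mul g).const_mul g) hN
      have s1 := h.split _ m1
      have s2 := h.split _ m2
      have s3 := h.split _ hN
      have s4 := h.split _ m3
      simp only [Set.mem_ofPred_eq] at s1 s2 s3 s4
      have z1 : μ.real {x | g * x - g ∈ N} = 0 := h.real_eq_zero h0 hg fun x hx hx' hxN => by
        have := hN0 hxN
        simp only [Set.mem_Ici] at this
        nlinarith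
      have e1 : ∀ x, g * (g * x) + g ^ 2 - g = g * (g * (x - g)) := fun x => by
        linear_combination g * hg
      have e2 : ∀ x, g * (g * x + g ^ 2) + g ^ 2 - g = g * (g * x) := fun x => by
        linear_combination g * hg
      simp only [e1, e2] at s2
      have p1 : 0 ≤ μ.real {x | g * x + g ^ 2 ∈ N} := measureReal_nonneg
      have p2 : 0 ≤ μ.real {x | g * (g * x + g ^ 2) ∈ N} := measureReal_nonneg
      have p3 : 0 ≤ μ.real {x | g * x ∈ N} := measureReal_nonneg
      have p4 : 0 ≤ μ.real {x | g * (g * x) ∈ N} := measureReal_nonneg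
      have z2 : μ.real {x | g * (g * x) ∈ N} = 0 := by linarith
      have hi := ih _ m4 (fun x hx => by
        have := hN0 hx
        simp only [Set.mem_Ici] at this ⊢
        by_contra hneg
        nlinarith [mul_pos h0 h0]) z2
      simp only [Set.mem_ofPred_eq] at hi
      rw [pow_succ]
      linarith
  refine le_antisymm (ge_of_tendsto' (tendsto_pow_atTop_nhds_zero_of_lt_one (r := (1 / 4 : ℝ))
    (by norm_num) (by norm_num)) fun n => key n N hN hN0 hz) measureReal_nonneg

/-- Null subsets of `(-∞, 1]` remain null when translated by `-g`. -/
lemma null_add (h : IsSelfSimilar g μ) (h0 : 0 < g) (hg : g ^ 2 = 1 - g) {N : Set ℝ}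
    (hN : MeasurableSet N) (hN0 : N ⊆ Set.Iic 1) (hz : μ.real N = 0) :
    μ.real {x | x + g ∈ N} = 0 := by
  have := h.prob
  have key : ∀ n : ℕ, ∀ N : Set ℝ, MeasurableSet N → N ⊆ Set.Iic 1 → μ.real N = 0 →
      μ.real {x | x + g ∈ N} ≤ (1 / 4) ^ n := by
    intro n
    induction n with
    | zero => intro N _ _ _; simp
    | succ n ih =>
      intro N hN hN0 hz
      have m1 : MeasurableSet {x | x + g ∈ N} := (measurable_add_const g) hN
      have m2 : MeasurableSet {x | g * x + g ∈ N} := ((measurable_const_mul g).add_const _) hN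
      have m3 : MeasurableSet {x | g * x + g ^ 2 ∈ N} :=
        ((measurable_const_mul g).add_const _) hN
      have m4 : MeasurableSet {x | g * (g * x) + g ∈ N} :=
        (((measurable_const_mul g).const_mul g).add_const _) hN
      have s1 := h.split _ m1
      have s2 := h.split _ m2
      have s3 := h.split _ hN
      have s4 := h.split _ m3
      simp only [Set.mem_ofPred_eq] at s1 s2 s3 s4
      have z1 : μ.real {x | g * x + g ^ 2 + g ∈ N} = 0 :=
        h.real_eq_zero h0 hg fun x hx hx' hxN => by
          have := hN0 hxN
          simp only [Set.mem_Iic] at this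
          nlinarith
      have e1 : ∀ x, g * (g * x + g ^ 2) + g = g * (g * (x + g)) + g := fun x => by ring
      have e2 : ∀ x, g * (g * x + g ^ 2) + g ^ 2 = g * (g * x) + g := fun x => by
        linear_combination g * hg
      simp only [e2] at s4
      simp only [e1] at s2
      have p1 : 0 ≤ μ.real {x | g * x ∈ N} := measureReal_nonneg
      have p2 : 0 ≤ μ.real {x | g * (g * x) + g ^ 2 ∈ N} := measureReal_nonneg
      have p3 : 0 ≤ μ.real {x | g * x + g ^ 2 ∈ N} := measureReal_nonneg
      have p4 : 0 ≤ μ.real {x | g * (g * x) + g ∈ N} := measureReal_nonneg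
      have z2 : μ.real {x | g * (g * x) + g ∈ N} = 0 := by linarith
      have hi := ih _ m4 (fun x hx => by
        have := hN0 hx
        simp only [Set.mem_Iic] at this ⊢
        by_contra hneg
        nlinarith [mul_pos h0 h0]) z2
      simp only [Set.mem_ofPred_eq] at hi
      rw [pow_succ]
      linarith
  refine le_antisymm (ge_of_tendsto' (tendsto_pow_atTop_nhds_zero_of_lt_one (r := (1 / 4 : ℝ))
    (by norm_num) (by norm_num)) fun n => key n N hN hN0 hz) measureReal_nonneg

/-- Null subsets of `[0, ∞)` remain null when translated by `g²`. -/
lemma null_sub_sq (h : IsSelfSimilar g μ) (h0 : 0 < g) (hg : g ^ 2 = 1 - g) {N : Set ℝ}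
    (hN : MeasurableSet N) (hN0 : N ⊆ Set.Ici 0) (hz : μ.real N = 0) :
    μ.real {x | x - g ^ 2 ∈ N} = 0 := by
  have m1 : MeasurableSet {x | x - g ^ 2 ∈ N} := (measurable_sub_const _) hN
  have m2 : MeasurableSet {x | g * x ∈ N} := (measurable_const_mul g) hN
  have s1 := h.split _ m1
  have s2 := h.split _ hN
  have p1 : 0 ≤ μ.real {x | g * x ∈ N} := measureReal_nonneg
  have p2 : 0 ≤ μ.real {x | g * x + g ^ 2 ∈ N} := measureReal_nonneg
  have z : μ.real {x | g * x ∈ N} = 0 := by linarith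
  have z' := h.null_sub h0 hg m2 (fun x hx => by
    have := hN0 hx
    simp only [Set.mem_Ici] at this ⊢
    by_contra hneg
    nlinarith) z
  have e1 : ∀ x, g * x - g ^ 2 = g * (x - g) := fun x => by ring
  simp only [Set.mem_ofPred_eq, add_sub_cancel_right, e1] at s1 z'
  rw [s1, z, z']
  simp

end IsSelfSimilar

/-! ### The golden mean transformation -/

lemma fract_gold_mul_of_lt {x : ℝ} (h0 : 0 ≤ x) (h1 : x < gold⁻¹) :
    Int.fract (gold * x) = gold * x := by
  have hg := inv_gold_pos
  have h : gold * gold⁻¹ = 1 := mul_inv_cancel₀ (by have := gold_eq; linarith)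
  have := gold_eq
  rw [Int.fract_eq_self]
  constructor <;> nlinarith

lemma fract_gold_mul_of_ge {x : ℝ} (h0 : gold⁻¹ ≤ x) (h1 : x < 1) :
    Int.fract (gold * x) = gold * x - 1 := by
  have hg := inv_gold_pos
  have h : gold * gold⁻¹ = 1 := mul_inv_cancel₀ (by have := gold_eq; linarith)
  have h2 := inv_gold_sq
  have := gold_eq
  rw [Int.fract_eq_iff]
  refine ⟨by nlinarith, by nlinarith, 1, by simp⟩

/-- A set invariant under `x ↦ {λ x}` is invariant under `x ↦ x - λ⁻²` on `[λ⁻², 1)`. -/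
lemma mem_iff_sub_sq_mem {E : Set ℝ}
    (hE : ∀ x, 0 ≤ x → x < 1 → (Int.fract (gold * x) ∈ E ↔ x ∈ E)) {x : ℝ}
    (h0 : gold⁻¹ ^ 2 ≤ x) (h1 : x < 1) : x ∈ E ↔ x - gold⁻¹ ^ 2 ∈ E := by
  have hg := inv_gold_pos
  have h : gold * gold⁻¹ = 1 := mul_inv_cancel₀ (by have := gold_eq; linarith)
  have h2 := inv_gold_sq
  have hgold := gold_eq
  have hlt : gold⁻¹ < 1 := by nlinarith
  have hhalf : 1 / 2 < gold⁻¹ := by nlinarith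
  have h38 : gold * gold⁻¹ ^ 2 = gold⁻¹ := by rw [pow_two, ← mul_assoc, h, one_mul]
  have key : ∀ n : ℕ, ∀ x, gold⁻¹ ^ 2 ≤ x → x < 1 → gold⁻¹ < gold ^ n * (1 - x) →
      (x ∈ E ↔ x - gold⁻¹ ^ 2 ∈ E) := by
    intro n
    induction n with
    | zero =>
      intro x h0 h1 hn
      nlinarith
    | succ n ih =>
      intro x h0 h1 hn
      rw [← hE x (by nlinarith) h1, ← hE (x - gold⁻¹ ^ 2) (by linarith) (by nlinarith)]
      rcases lt_or_ge x gold⁻¹ with hx | hx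
      · have hlow : 0 ≤ gold * x - gold⁻¹ := by nlinarith
        rw [fract_gold_mul_of_lt (by nlinarith) hx,
          fract_gold_mul_of_lt (by linarith) (by nlinarith), mul_sub, h38,
          ← hE (gold * x) (by nlinarith) (by nlinarith),
          ← hE (gold * x - gold⁻¹) hlow (by nlinarith),
          fract_gold_mul_of_ge (by linarith) (by nlinarith),
          fract_gold_mul_of_lt hlow (by nlinarith), mul_sub, h]
      · rw [fract_gold_mul_of_ge hx h1, fract_gold_mul_of_lt (by linarith) (by nlinarith),
          mul_sub, h38, ih (gold * x - gold⁻¹) (by nlinarith) (by nlinarith) ?_]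
        · rw [show gold * x - gold⁻¹ - gold⁻¹ ^ 2 = gold * x - 1 by linarith]
        · calc gold⁻¹ < gold ^ (n + 1) * (1 - x) := hn
            _ = gold ^ n * (gold * (1 - x)) := by ring
            _ = gold ^ n * (1 - (gold * x - gold⁻¹)) := by congr 1; linarith
  have hgt : 1 < gold := by linarith
  obtain ⟨n, hn⟩ := pow_unbounded_of_one_lt (gold⁻¹ / (1 - x)) hgt
  exact key n x h0 h1 ((div_lt_iff₀ (by linarith)).1 hn)

lemma mul_mem_iff {E : Set ℝ}
    (hE : ∀ x, 0 ≤ x → x < 1 → (Int.fract (gold * x) ∈ E ↔ x ∈ E)) {x : ℝ}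
    (h0 : 0 < x) (h1 : x < 1) : gold⁻¹ * x ∈ E ↔ x ∈ E := by
  have hg := inv_gold_pos
  have h : gold * gold⁻¹ = 1 := mul_inv_cancel₀ (by have := gold_eq; linarith)
  have h2 := inv_gold_sq
  rw [← hE (gold⁻¹ * x) (by positivity) (by nlinarith),
    fract_gold_mul_of_lt (by positivity) (by nlinarith), ← mul_assoc, h, one_mul]

lemma mul_add_sq_mem_iff {E : Set ℝ}
    (hE : ∀ x, 0 ≤ x → x < 1 → (Int.fract (gold * x) ∈ E ↔ x ∈ E)) {x : ℝ}
    (h0 : 0 < x) (h1 : x < 1) : gold⁻¹ * x + gold⁻¹ ^ 2 ∈ E ↔ x ∈ E := by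
  have hg := inv_gold_pos
  have h : gold * gold⁻¹ = 1 := mul_inv_cancel₀ (by have := gold_eq; linarith)
  have h2 := inv_gold_sq
  have hgold := gold_eq
  have e : gold * (gold⁻¹ * x + gold⁻¹ ^ 2) = x + gold⁻¹ := by
    linear_combination (x + gold⁻¹) * h
  rw [← hE (gold⁻¹ * x + gold⁻¹ ^ 2) (by positivity) (by nlinarith)]
  rcases lt_or_ge x (gold⁻¹ ^ 2) with hx | hx
  · rw [fract_gold_mul_of_lt (by positivity) (by nlinarith), e,
      ← hE (x + gold⁻¹) (by positivity) (by linarith), ← hE x h0.le h1,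
      fract_gold_mul_of_ge (by linarith) (by linarith), fract_gold_mul_of_lt h0.le (by nlinarith),
      mul_add, h, add_sub_cancel_right]
  · rw [fract_gold_mul_of_ge (by nlinarith) (by nlinarith), e, mem_iff_sub_sq_mem hE hx h1]
    rw [show x + gold⁻¹ - 1 = x - gold⁻¹ ^ 2 by linarith]

lemma IsCoinMeasure.erdosOf_zero_or_one {p : Measure (ℕ → Bool)} (hp : IsCoinMeasure p)
    {E : Set ℝ} (hm : MeasurableSet E)
    (hE : ∀ x, 0 ≤ x → x < 1 → (Int.fract (gold * x) ∈ E ↔ x ∈ E)) :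
    erdosOf p E = 0 ∨ erdosOf p E = 1 := by
  unfold erdosOf
  rw [Measure.map_apply measurable_piMap hm]
  refine hp.zero_or_one (measurable_piMap hm) fun c => ?_
  have hae := ae_of_ae_map measurable_piMap.aemeasurable
    (hp.isSelfSimilar.ae_mem_Ioo inv_gold_pos inv_gold_sq)
  filter_upwards [hae] with ε hε
  apply propext
  change piMap (consSeq c ε) ∈ E ↔ piMap ε ∈ E
  rw [piMap_consSeq]
  cases c
  · simpa using mul_mem_iff hE hε.1 hε.2
  · simpa using mul_add_sq_mem_iff hE hε.1 hε.2

/-! ### The measure `nuOf p` -/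

section nuOf

variable {p : Measure (ℕ → Bool)}

lemma nuOf_apply [IsFiniteMeasure (erdosOf p)] {E : Set ℝ} (hE : MeasurableSet E) :
    nuOf p E = ENNReal.ofReal (
      2 / 3 * (erdosOf p).real (E ∩ Set.Ico 0 gold⁻¹)
      + 1 / 3 * (erdosOf p).real {x | x - gold⁻¹ ^ 2 ∈ E ∩ Set.Ico 0 gold⁻¹}
      + 1 / 6 * (erdosOf p).real {x | x - gold⁻¹ ∈ E ∩ Set.Ico 0 (gold⁻¹ ^ 2)}
      + 1 / 2 * (erdosOf p).real (E ∩ Set.Icc gold⁻¹ 1)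
      + 1 / 3 * (erdosOf p).real {x | x + gold⁻¹ ∈ E ∩ Set.Icc gold⁻¹ 1}) := by
  have hg := inv_gold_pos
  have h2 := inv_gold_sq
  have hlt : gold⁻¹ ^ 2 < gold⁻¹ := by nlinarith
  have m1 := hE.inter (measurableSet_Ico (a := (0 : ℝ)) (b := gold⁻¹ ^ 2))
  have m2 := hE.inter (measurableSet_Ico (a := gold⁻¹ ^ 2) (b := gold⁻¹))
  have m3 := hE.inter (measurableSet_Icc (a := gold⁻¹) (b := (1 : ℝ)))
  have hu : E ∩ Set.Ico 0 gold⁻¹ =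
      (E ∩ Set.Ico 0 (gold⁻¹ ^ 2)) ∪ (E ∩ Set.Ico (gold⁻¹ ^ 2) gold⁻¹) := by
    rw [← Set.inter_union_distrib_left, Set.Ico_union_Ico_eq_Ico (by positivity) hlt.le]
  have hd : Disjoint (E ∩ Set.Ico 0 (gold⁻¹ ^ 2)) (E ∩ Set.Ico (gold⁻¹ ^ 2) gold⁻¹) := by
    rw [Set.disjoint_left]
    rintro x ⟨-, hx⟩ ⟨-, hx'⟩
    exact absurd hx.2 (not_lt.2 hx'.1)
  have u1 : (erdosOf p).real (E ∩ Set.Ico 0 gold⁻¹) =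
      (erdosOf p).real (E ∩ Set.Ico 0 (gold⁻¹ ^ 2)) +
      (erdosOf p).real (E ∩ Set.Ico (gold⁻¹ ^ 2) gold⁻¹) := by
    rw [hu, measureReal_union hd m2]
  have u2 : (erdosOf p).real ((fun x => x - gold⁻¹ ^ 2) ⁻¹' (E ∩ Set.Ico 0 gold⁻¹)) =
      (erdosOf p).real ((fun x => x - gold⁻¹ ^ 2) ⁻¹' (E ∩ Set.Ico 0 (gold⁻¹ ^ 2))) +
      (erdosOf p).real ((fun x => x - gold⁻¹ ^ 2) ⁻¹' (E ∩ Set.Ico (gold⁻¹ ^ 2) gold⁻¹)) := by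
    rw [hu, Set.preimage_union,
      measureReal_union (hd.preimage _) ((measurable_sub_const _) m2)]
  change _ = ENNReal.ofReal (
      2 / 3 * (erdosOf p).real (E ∩ Set.Ico 0 gold⁻¹)
      + 1 / 3 * (erdosOf p).real ((fun x => x - gold⁻¹ ^ 2) ⁻¹' (E ∩ Set.Ico 0 gold⁻¹))
      + 1 / 6 * (erdosOf p).real ((fun x => x - gold⁻¹) ⁻¹' (E ∩ Set.Ico 0 (gold⁻¹ ^ 2)))
      + 1 / 2 * (erdosOf p).real (E ∩ Set.Icc gold⁻¹ 1)
      + 1 / 3 * (erdosOf p).real ((fun x => x + gold⁻¹) ⁻¹' (E ∩ Set.Icc gold⁻¹ 1)))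
  rw [u1, u2, nuOf]
  simp only [Measure.coe_add, Pi.add_apply, Measure.restrict_apply hE, Measure.coe_smul,
    Pi.smul_apply, smul_eq_mul]
  rw [Measure.map_apply (measurable_sub_const _) m1, Measure.map_apply (measurable_sub_const _) m1,
    Measure.map_apply (measurable_sub_const _) m2, Measure.map_apply (measurable_add_const _) m3]
  have h23 : (2 / 3 : ℝ≥0∞) ≠ ∞ := ENNReal.div_ne_top (by simp) (by simp)
  refine (ENNReal.toReal_eq_toReal_iff' (by finiteness) ENNReal.ofReal_ne_top).1 ?_
  rw [ENNReal.toReal_ofReal (by positivity)]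
  repeat rw [ENNReal.toReal_add (by finiteness) (by finiteness)]
  simp only [ENNReal.toReal_mul, ENNReal.toReal_inv, ENNReal.toReal_ofNat, ENNReal.toReal_div,
    measureReal_def]
  ring

lemma nuOf_univ (h : IsSelfSimilar gold⁻¹ (erdosOf p)) : nuOf p Set.univ = 1 := by
  have := h.prob
  rw [nuOf_apply MeasurableSet.univ]
  simp only [Set.univ_inter]
  have h0 := inv_gold_pos
  have hg := inv_gold_sq
  generalize gold⁻¹ = g at *
  generalize erdosOf p = μ at *
  have hhalf : 1 / 2 < g := by nlinarith
  have hlt : g < 1 := by nlinarith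
  have s1 := h.split _ (measurableSet_Iio (a := g))
  have s2 := h.split _ (measurableSet_Iio (a := g ^ 2))
  simp only [Set.mem_Iio] at s1 s2
  rw [h.real_eq_one h0 hg (P := {x | g * x < g}) fun x hx hx' => by
      simp only [Set.mem_ofPred_eq]; nlinarith,
    h.real_congr h0 hg (P := {x | g * x + g ^ 2 < g}) (Q := Set.Iio (g ^ 2)) fun x hx hx' => by
      simp only [Set.mem_ofPred_eq, Set.mem_Iio]
      constructor
      · intro hx; by_contra hc; nlinarith
      · intro hx; nlinarith] at s1
  rw [h.real_congr h0 hg (P := {x | g * x < g ^ 2}) (Q := Set.Iio g) fun x hx hx' => by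
      simp only [Set.mem_ofPred_eq, Set.mem_Iio]
      constructor
      · intro hx; by_contra hc; nlinarith
      · intro hx; nlinarith,
    h.real_eq_zero h0 hg (P := {x | g * x + g ^ 2 < g ^ 2}) fun x hx hx' => by
      simp only [Set.mem_ofPred_eq, not_lt]; nlinarith] at s2
  have c1 := probReal_compl_eq_one_sub (μ := μ) (measurableSet_Iio (a := g))
  have c2 := probReal_compl_eq_one_sub (μ := μ) (measurableSet_Iio (a := g ^ 2))
  rw [h.real_congr h0 hg (P := Set.Ico 0 g) (Q := Set.Iio g) fun x hx hx' => by
      simp [hx.le],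
    h.real_congr h0 hg (P := {x | x - g ^ 2 ∈ Set.Ico 0 g}) (Q := (Set.Iio (g ^ 2))ᶜ)
      fun x hx hx' => by
        simp only [Set.mem_ofPred_eq, Set.mem_Ico, Set.mem_compl_iff, Set.mem_Iio, not_lt]
        exact ⟨fun h => by linarith [h.1], fun h => ⟨by linarith, by linarith⟩⟩,
    h.real_congr h0 hg (P := {x | x - g ∈ Set.Ico 0 (g ^ 2)}) (Q := (Set.Iio g)ᶜ)
      fun x hx hx' => by
        simp only [Set.mem_ofPred_eq, Set.mem_Ico, Set.mem_compl_iff, Set.mem_Iio, not_lt]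
        exact ⟨fun h => by linarith [h.1], fun h => ⟨by linarith, by linarith⟩⟩,
    h.real_congr h0 hg (P := Set.Icc g 1) (Q := (Set.Iio g)ᶜ) fun x hx hx' => by
      simp [hx'.le],
    h.real_congr h0 hg (P := {x | x + g ∈ Set.Icc g 1}) (Q := Set.Iic (g ^ 2))
      fun x hx hx' => by
        simp only [Set.mem_ofPred_eq, Set.mem_Icc, Set.mem_Iic]
        exact ⟨fun h => by linarith [h.2], fun h => ⟨by linarith, by linarith⟩⟩, c1, c2]
  have s3 := h.split _ (measurableSet_Iic (a := g))
  have s4 := h.split _ (measurableSet_Iic (a := g ^ 2))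
  simp only [Set.mem_Iic] at s3 s4
  rw [h.real_eq_one h0 hg (P := {x | g * x ≤ g}) fun x hx hx' => by
      simp only [Set.mem_ofPred_eq]; nlinarith,
    h.real_congr h0 hg (P := {x | g * x + g ^ 2 ≤ g}) (Q := Set.Iic (g ^ 2)) fun x hx hx' => by
      simp only [Set.mem_ofPred_eq, Set.mem_Iic]
      constructor
      · intro hx; by_contra hc; nlinarith
      · intro hx; nlinarith] at s3
  rw [h.real_congr h0 hg (P := {x | g * x ≤ g ^ 2}) (Q := Set.Iic g) fun x hx hx' => by
      simp only [Set.mem_ofPred_eq, Set.mem_Iic]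
      constructor
      · intro hx; by_contra hc; nlinarith
      · intro hx; nlinarith,
    h.real_eq_zero h0 hg (P := {x | g * x + g ^ 2 ≤ g ^ 2}) fun x hx hx' => by
      simp only [Set.mem_ofPred_eq, not_le]; nlinarith] at s4
  rw [← ENNReal.ofReal_one]
  congr 1
  linarith

lemma nuOf_eq_zero_iff (h : IsSelfSimilar gold⁻¹ (erdosOf p)) {E : Set ℝ}
    (hE : MeasurableSet E) : nuOf p E = 0 ↔ erdosOf p E = 0 := by
  have := h.prob
  rw [nuOf_apply hE, ENNReal.ofReal_eq_zero, ← measureReal_eq_zero_iff]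
  have h0 := inv_gold_pos
  have hg := inv_gold_sq
  generalize gold⁻¹ = g at *
  generalize erdosOf p = μ at *
  constructor
  · intro hz
    have p1 : 0 ≤ μ.real (E ∩ Set.Ico 0 g) := measureReal_nonneg
    have p2 : 0 ≤ μ.real {x | x - g ^ 2 ∈ E ∩ Set.Ico 0 g} := measureReal_nonneg
    have p3 : 0 ≤ μ.real {x | x - g ∈ E ∩ Set.Ico 0 (g ^ 2)} := measureReal_nonneg
    have p4 : 0 ≤ μ.real (E ∩ Set.Icc g 1) := measureReal_nonneg
    have p5 : 0 ≤ μ.real {x | x + g ∈ E ∩ Set.Icc g 1} := measureReal_nonneg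
    refine le_antisymm ?_ measureReal_nonneg
    rw [h.real_congr h0 hg (P := E) (Q := (E ∩ Set.Ico 0 g) ∪ (E ∩ Set.Icc g 1))
      fun x hx hx' => by
        simp only [Set.mem_union, Set.mem_inter_iff, Set.mem_Ico, Set.mem_Icc]
        have := lt_or_ge x g
        constructor
        · intro hxE
          rcases this with hc | hc
          · exact Or.inl ⟨hxE, hx.le, hc⟩
          · exact Or.inr ⟨hxE, hc, hx'.le⟩
        · rintro (h | h) <;> exact h.1]
    refine (measureReal_union_le _ _).trans ?_
    linarith
  · intro hz
    have sub : ∀ S, μ.real (E ∩ S) = 0 := fun S =>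
      le_antisymm ((measureReal_mono Set.inter_subset_left).trans hz.le) measureReal_nonneg
    rw [sub, sub, h.null_sub_sq h0 hg (hE.inter measurableSet_Ico) (fun x hx => hx.2.1) (sub _),
      h.null_sub h0 hg (hE.inter measurableSet_Ico) (fun x hx => hx.2.1) (sub _),
      h.null_add h0 hg (hE.inter measurableSet_Icc) (fun x hx => hx.2.2) (sub _)]
    simp

set_option maxHeartbeats 1000000 in
lemma nuOf_preimage (h : IsSelfSimilar gold⁻¹ (erdosOf p)) {E : Set ℝ}
    (hE : MeasurableSet E) (hE1 : E ⊆ Set.Ico 0 1) :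
    nuOf p {x | x ∈ Set.Ico (0 : ℝ) 1 ∧ Int.fract (gold * x) ∈ E} = nuOf p E := by
  have := h.prob
  have hm : MeasurableSet {x | x ∈ Set.Ico (0 : ℝ) 1 ∧ Int.fract (gold * x) ∈ E} :=
    measurableSet_Ico.inter ((measurable_fract.comp (measurable_const_mul gold)) hE)
  have hlow : ∀ x, x ∈ {x | x ∈ Set.Ico (0 : ℝ) 1 ∧ Int.fract (gold * x) ∈ E} ∩
      Set.Ico 0 gold⁻¹ ↔ gold * x ∈ E ∧ x ∈ Set.Ico 0 gold⁻¹ := fun x => by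
    have h0 := inv_gold_pos
    have hg := inv_gold_sq
    simp only [Set.mem_inter_iff, Set.mem_ofPred_eq, Set.mem_Ico]
    constructor
    · rintro ⟨⟨-, hx⟩, h1, h2⟩
      rw [fract_gold_mul_of_lt h1 h2] at hx
      exact ⟨hx, h1, h2⟩
    · rintro ⟨hx, h1, h2⟩
      rw [fract_gold_mul_of_lt h1 h2]
      exact ⟨⟨⟨h1, by nlinarith⟩, hx⟩, h1, h2⟩
  have hlow' : ∀ x, x ∈ {x | x ∈ Set.Ico (0 : ℝ) 1 ∧ Int.fract (gold * x) ∈ E} ∩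
      Set.Ico 0 (gold⁻¹ ^ 2) ↔ gold * x ∈ E ∧ x ∈ Set.Ico 0 (gold⁻¹ ^ 2) := fun x => by
    have h0 := inv_gold_pos
    have hg := inv_gold_sq
    have hx := hlow x
    simp only [Set.mem_inter_iff, Set.mem_ofPred_eq, Set.mem_Ico] at hx ⊢
    have : x < gold⁻¹ ^ 2 → x < gold⁻¹ := fun h => by nlinarith
    tauto
  have hhigh : ∀ x, x ∈ {x | x ∈ Set.Ico (0 : ℝ) 1 ∧ Int.fract (gold * x) ∈ E} ∩
      Set.Icc gold⁻¹ 1 ↔ gold * x - 1 ∈ E ∧ x ∈ Set.Ico gold⁻¹ 1 := fun x => by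
    have h0 := inv_gold_pos
    simp only [Set.mem_inter_iff, Set.mem_ofPred_eq, Set.mem_Ico, Set.mem_Icc]
    constructor
    · rintro ⟨⟨⟨h1, h2⟩, hx⟩, h3, h4⟩
      rw [fract_gold_mul_of_ge h3 h2] at hx
      exact ⟨hx, h3, h2⟩
    · rintro ⟨hx, h1, h2⟩
      rw [fract_gold_mul_of_ge h1 h2]
      exact ⟨⟨⟨by linarith, h2⟩, hx⟩, h1, h2.le⟩
  rw [nuOf_apply hm, nuOf_apply hE]
  have t1 := h.split _ (hm.inter (measurableSet_Ico (a := (0 : ℝ)) (b := gold⁻¹)))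
  have t2 := h.split _ ((measurable_sub_const (gold⁻¹ ^ 2))
    (hm.inter (measurableSet_Ico (a := (0 : ℝ)) (b := gold⁻¹))))
  have t3 := h.split _ ((measurable_sub_const gold⁻¹)
    (hm.inter (measurableSet_Ico (a := (0 : ℝ)) (b := gold⁻¹ ^ 2))))
  have t4 := h.split _ (hm.inter (measurableSet_Icc (a := gold⁻¹) (b := (1 : ℝ))))
  have t5 := h.split _ ((measurable_add_const gold⁻¹)
    (hm.inter (measurableSet_Icc (a := gold⁻¹) (b := (1 : ℝ)))))
  simp only [Set.preimage, hlow, hlow', hhigh, Set.mem_ofPred_eq] at t1 t2 t3 t4 t5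
  simp only [hlow, hlow', hhigh]
  have hs : ({x | x ∈ Set.Ico (0 : ℝ) 1 ∧ Int.fract (gold * x) ∈ E} ∩ Set.Ico 0 gold⁻¹) =
    {x | gold * x ∈ E ∧ x ∈ Set.Ico 0 gold⁻¹} := Set.ext hlow
  have hs' : ({x | x ∈ Set.Ico (0 : ℝ) 1 ∧ Int.fract (gold * x) ∈ E} ∩ Set.Icc gold⁻¹ 1) =
    {x | gold * x - 1 ∈ E ∧ x ∈ Set.Ico gold⁻¹ 1} := Set.ext hhigh
  rw [hs] at t1 ⊢
  rw [hs'] at t4 ⊢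
  clear hs hs' hlow hlow' hhigh hm
  have h0 := inv_gold_pos
  have hg := inv_gold_sq
  have hgold := gold_eq
  have e1 : ∀ x, gold * (gold⁻¹ * x) = x := fun x => by
    rw [← mul_assoc, mul_inv_cancel₀ (by linarith), one_mul]
  have e2 : gold * gold⁻¹ ^ 2 = gold⁻¹ := by rw [pow_two, e1]
  have e3 : gold * gold⁻¹ = 1 := by simpa using e1 1
  simp only [mul_add, mul_sub, e1, e2, e3, add_sub_cancel_right] at t1 t2 t3 t4 t5 ⊢
  clear e1 e2 e3
  generalize gold⁻¹ = g at *
  generalize erdosOf p = μ at *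
  clear hgold
  have hhalf : 1 / 2 < g := by nlinarith
  have hlt : g < 1 := by nlinarith
  have hA : μ.real E = μ.real (E ∩ Set.Ico 0 g) + μ.real (E ∩ Set.Icc g 1) := by
    refine h.real_add (hE.inter measurableSet_Icc) ?_ ?_
    · ext x
      simp only [Set.mem_union, Set.mem_inter_iff, Set.mem_Ico, Set.mem_Icc]
      constructor
      · intro hx
        have := hE1 hx
        rcases lt_or_ge x g with hc | hc
        · exact Or.inr ⟨hx, this.1, hc⟩
        · exact Or.inl ⟨hx, hc, this.2.le⟩
      · rintro (h | h) <;> exact h.1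
    · rw [Set.disjoint_left]
      rintro x ⟨-, hx⟩ ⟨-, hx'⟩
      exact absurd hx.2 (not_lt.2 hx'.1)
  have ltE : ∀ {y}, y ∈ E → y < 1 := fun hy => (hE1 hy).2
  have geE : ∀ {y}, y ∈ E → 0 ≤ y := fun hy => (hE1 hy).1
  have r1 : μ.real {x | x ∈ E ∧ g * x ∈ Set.Ico 0 g} = μ.real E :=
    h.real_congr h0 hg fun x hx hx' => by
      simp only [Set.mem_ofPred_eq, Set.mem_Ico, and_iff_left_iff_imp]
      intro hxE
      constructor <;> nlinarith
  have r2 : μ.real {x | x + g ∈ E ∧ g * x + g ^ 2 ∈ Set.Ico 0 g} =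
      μ.real {x | x + g ∈ E ∩ Set.Icc g 1} := h.real_congr h0 hg fun x hx hx' => by
    simp only [Set.mem_ofPred_eq, Set.mem_Ico, Set.mem_inter_iff, Set.mem_Icc]
    refine and_congr_right fun hxE => ?_
    have := ltE hxE
    refine iff_of_true ⟨by positivity, by nlinarith⟩ ⟨by linarith, by linarith⟩
  have r3 : μ.real {x | x - g ∈ E ∧ g * x - g ^ 2 ∈ Set.Ico 0 g} =
      μ.real {x | x - g ∈ E ∩ Set.Ico 0 (g ^ 2)} := h.real_congr h0 hg fun x hx hx' => by
    simp only [Set.mem_ofPred_eq, Set.mem_Ico, Set.mem_inter_iff]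
    refine and_congr_right fun hxE => ?_
    have := geE hxE
    refine iff_of_true ⟨by nlinarith, by nlinarith⟩ ⟨by linarith, by linarith⟩
  have r4 : ∀ Q : ℝ → Prop, μ.real {x | x - 1 ∈ E ∧ Q x} = 0 := fun Q =>
    h.real_eq_zero h0 hg fun x hx hx' hxE => by
      have := geE hxE.1
      linarith
  have r5 : μ.real {x | x + g - 1 ∈ E ∧ g * x + g ^ 2 - g ∈ Set.Ico 0 (g ^ 2)} =
      μ.real {x | x - g ^ 2 ∈ E ∩ Set.Ico 0 g} := h.real_congr h0 hg fun x hx hx' => by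
    simp only [Set.mem_ofPred_eq, Set.mem_Ico, Set.mem_inter_iff]
    rw [show x + g - 1 = x - g ^ 2 by linarith]
    refine and_congr_right fun hxE => ?_
    have := geE hxE
    refine iff_of_true ⟨by nlinarith, by nlinarith⟩ ⟨by linarith, by linarith⟩
  have r6 : μ.real {x | x + g - 1 ∈ E ∧ g * x + g ^ 2 ∈ Set.Ico g 1} =
      μ.real {x | x - g ^ 2 ∈ E ∩ Set.Ico 0 g} := h.real_congr h0 hg fun x hx hx' => by
    simp only [Set.mem_ofPred_eq, Set.mem_Ico, Set.mem_inter_iff]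
    rw [show x + g - 1 = x - g ^ 2 by linarith]
    refine and_congr_right fun hxE => ?_
    have := geE hxE
    refine iff_of_true ⟨by nlinarith, by nlinarith⟩ ⟨by linarith, by linarith⟩
  have r7 : μ.real {x | x ∈ E ∧ g * x + g ∈ Set.Ico g 1} = μ.real (E ∩ Set.Ico 0 g) :=
    h.real_congr h0 hg fun x hx hx' => by
      simp only [Set.mem_ofPred_eq, Set.mem_Ico, Set.mem_inter_iff]
      refine and_congr_right fun hxE => ?_
      constructor
      · rintro ⟨-, hlt'⟩
        refine ⟨hx.le, ?_⟩
        by_contra hc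
        nlinarith
      · rintro ⟨-, hlt'⟩
        constructor <;> nlinarith
  have r8 : μ.real {x | x + g ∈ E ∧ g * x + g ^ 2 + g ∈ Set.Ico g 1} = 0 :=
    h.real_eq_zero h0 hg fun x hx hx' hxE => by
      have := hxE.2.2
      nlinarith
  rw [r1, r2] at t1
  rw [r3, r1] at t2
  rw [r4, r5] at t3
  rw [r4, r6] at t4
  rw [r7, r8] at t5
  rw [t1, t2, t3, t4, t5, hA]
  congr 1
  ring

end nuOf

/-- ν is a `T`-invariant ergodic Borel probability measure equivalent to the Erdős
measure μ. -/
theorem nu_invariant_ergodic_equivalent (p : Measure (ℕ → Bool)) (hp : IsCoinMeasure p) :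
    IsProbabilityMeasure (nuOf p) ∧
    (∀ E : Set ℝ, MeasurableSet E → E ⊆ Set.Ico 0 1 →
      nuOf p {x | x ∈ Set.Ico (0 : ℝ) 1 ∧ Int.fract (gold * x) ∈ E} = nuOf p E) ∧
    (∀ E : Set ℝ, MeasurableSet E → E ⊆ Set.Ico 0 1 →
      {x | x ∈ Set.Ico (0 : ℝ) 1 ∧ Int.fract (gold * x) ∈ E} = E →
        nuOf p E = 0 ∨ nuOf p E = 1) ∧
    (∀ E : Set ℝ, MeasurableSet E → (nuOf p E = 0 ↔ erdosOf p E = 0)) := by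
  have h := hp.isSelfSimilar
  have := h.prob
  have huniv := nuOf_univ h
  refine ⟨⟨huniv⟩, fun E hE hE1 => nuOf_preimage h hE hE1, fun E hE hE1 hinv => ?_,
    fun E hE => nuOf_eq_zero_iff h hE⟩
  have hE' : ∀ x, 0 ≤ x → x < 1 → (Int.fract (gold * x) ∈ E ↔ x ∈ E) := fun x hx hx' => by
    conv_rhs => rw [← hinv]
    simp [hx, hx']
  rcases hp.erdosOf_zero_or_one hE hE' with h0 | h1
  · exact Or.inl ((nuOf_eq_zero_iff h hE).2 h0)
  · right
    have : IsProbabilityMeasure (nuOf p) := ⟨huniv⟩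
    rw [← prob_compl_eq_zero_iff hE] at h1 ⊢
    exact (nuOf_eq_zero_iff h hE.compl).2 h1
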